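/- Milnor's split exact sequence: for a field F, the tame symbols at all monic irreducible polynomials assemble into a short exact sequence 0 → K^M_n(F) → K^M_n(F(t)) → ⊕_π K^M_{n-1}(F[t]/(π)) → 0, where the first map is induced by the inclusion F ⊂ F(t) and the sum ranges over monic irreducible π ∈ F[t]. In particular the map ⊕_π ∂_π is surjective. -/

import Mathlib

open Polynomial

/-- Milnor K-theory in degree `n` of a commutative ring `R` (used for fields and
their residue rings): the free abelian group on `n`-tuples of units modulo
multilinearity and the Steinberg relations `{…, f, 1-f, …} = 0` in adjacent slots. -/
def MilnorRel (R : Type*) [CommRing R] (n : ℕ) :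
    AddSubgroup (FreeAbelianGroup (Fin n → Rˣ)) :=
  AddSubgroup.closure
    ({x | ∃ (f : Fin n → Rˣ) (i : Fin n) (a b : Rˣ), f i = a * b ∧
        x = FreeAbelianGroup.of f - FreeAbelianGroup.of (Function.update f i a)
          - FreeAbelianGroup.of (Function.update f i b)} ∪
     {x | ∃ (f : Fin n → Rˣ) (i j : Fin n), (i : ℕ) + 1 = (j : ℕ) ∧
        ((f i : R) + (f j : R) = 1) ∧ x = FreeAbelianGroup.of f})

def MilnorK (R : Type*) [CommRing R] (n : ℕ) :=
  FreeAbelianGroup (Fin n → Rˣ) ⧸ MilnorRel R n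

instance (R : Type*) [CommRing R] (n : ℕ) : AddCommGroup (MilnorK R n) :=
  QuotientAddGroup.Quotient.addCommGroup _

/-- The symbol `{f_1, …, f_n}`. -/
def MilnorSymbol {R : Type*} [CommRing R] {n : ℕ} (f : Fin n → Rˣ) : MilnorK R n :=
  QuotientAddGroup.mk (FreeAbelianGroup.of f)

/-- `D : K^M_{n+1}(F(t)) → K^M_n(F[t]/(π))` is the tame symbol at the monic
irreducible `π ∈ F[t]`: it sends `{π, x_2, …, x_{n+1}}` to `{x̄_2, …, x̄_{n+1}}`
for `x_i ∈ F[t]` coprime to `π`, and kills symbols all of whose entries come from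
polynomials coprime to `π`. -/
def IsTameSymbol (F : Type*) [Field F] (n : ℕ) (π : F[X])
    (D : MilnorK (RatFunc F) (n + 1) →+ MilnorK (F[X] ⧸ Ideal.span {π}) n) : Prop :=
  (∀ x : Fin n → F[X], (∀ i, IsCoprime (x i) π) →
    ∀ (u : Fin (n + 1) → (RatFunc F)ˣ) (v : Fin n → (F[X] ⧸ Ideal.span {π})ˣ),
      (u 0 : RatFunc F) = algebraMap F[X] (RatFunc F) π →
      (∀ i : Fin n, (u i.succ : RatFunc F) = algebraMap F[X] (RatFunc F) (x i)) →
      (∀ i, (v i : F[X] ⧸ Ideal.span {π}) = Ideal.Quotient.mk (Ideal.span {π}) (x i)) →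
      D (MilnorSymbol u) = MilnorSymbol v) ∧
  (∀ x : Fin (n + 1) → F[X], (∀ i, IsCoprime (x i) π) →
    ∀ u : Fin (n + 1) → (RatFunc F)ˣ,
      (∀ i, (u i : RatFunc F) = algebraMap F[X] (RatFunc F) (x i)) →
      D (MilnorSymbol u) = 0)

namespace MilnorK

open Function

section CommRing

variable {R : Type*} [CommRing R] {n : ℕ} {A : Type*} [AddCommGroup A]

theorem symbol_update_mul (f : Fin n → Rˣ) (i : Fin n) (a b : Rˣ) :
    MilnorSymbol (update f i (a * b)) =
      MilnorSymbol (update f i a) + MilnorSymbol (update f i b) := by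
  have h : FreeAbelianGroup.of (update f i (a * b)) - FreeAbelianGroup.of (update f i a)
      - FreeAbelianGroup.of (update f i b) ∈ MilnorRel R n :=
    AddSubgroup.subset_closure (Or.inl ⟨update f i (a * b), i, a, b, by simp, by simp⟩)
  have h' := (QuotientAddGroup.eq_zero_iff _).2 h
  rw [sub_sub] at h'
  exact sub_eq_zero.1 h'

theorem symbol_eq_zero_of_succ (f : Fin n → Rˣ) {i j : Fin n} (hij : (i : ℕ) + 1 = j)
    (h : (f i : R) + f j = 1) : MilnorSymbol f = 0 :=
  (QuotientAddGroup.eq_zero_iff _).2 (AddSubgroup.subset_closure (Or.inr ⟨f, i, j, hij, h, rfl⟩))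

/-- The homomorphism out of Milnor K-theory induced by a multilinear function satisfying the
Steinberg relations. -/
def lift (φ : (Fin n → Rˣ) → A)
    (hmul : ∀ f i a b, φ (update f i (a * b)) = φ (update f i a) + φ (update f i b))
    (hst : ∀ (f : Fin n → Rˣ) (i j : Fin n), (i : ℕ) + 1 = j → (f i : R) + f j = 1 → φ f = 0) :
    MilnorK R n →+ A :=
  QuotientAddGroup.lift (MilnorRel R n) (FreeAbelianGroup.lift φ) <| by
    rw [MilnorRel, AddSubgroup.closure_le]
    rintro _ (⟨f, i, a, b, hf, rfl⟩ | ⟨f, i, j, hij, hf, rfl⟩)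
    · have h := hmul f i a b
      rw [← hf, update_eq_self] at h
      simp [h]
    · simpa using hst f i j hij hf

@[simp]
theorem lift_symbol (φ : (Fin n → Rˣ) → A) (hmul) (hst) (f : Fin n → Rˣ) :
    lift φ hmul hst (MilnorSymbol f) = φ f :=
  FreeAbelianGroup.lift_apply_of φ f

theorem closure_range_symbol :
    AddSubgroup.closure (Set.range (MilnorSymbol (R := R) (n := n))) = ⊤ := by
  rw [eq_top_iff]
  rintro ⟨x⟩ -
  change (QuotientAddGroup.mk x : MilnorK R n) ∈ _
  induction x using FreeAbelianGroup.induction_on with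
  | zero => exact zero_mem _
  | of f => exact AddSubgroup.subset_closure ⟨f, rfl⟩
  | neg f h => exact neg_mem h
  | add x y hx hy => exact add_mem hx hy

/-- Multilinearity reduces membership of symbols to symbols whose entries generate. -/
theorem symbol_mem_of_closure {S : Fin n → Set Rˣ} {B : AddSubgroup (MilnorK R n)}
    (h : ∀ f : Fin n → Rˣ, (∀ i, f i ∈ S i) → MilnorSymbol f ∈ B) (f : Fin n → Rˣ)
    (hf : ∀ i, f i ∈ Subgroup.closure (S i)) : MilnorSymbol f ∈ B := by
  suffices H : ∀ s : Finset (Fin n), ∀ f : Fin n → Rˣ,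
      (∀ i ∈ s, f i ∈ Subgroup.closure (S i)) → (∀ i ∉ s, f i ∈ S i) → MilnorSymbol f ∈ B from
    H Finset.univ f (fun i _ => hf i) (by simp)
  intro s
  induction s using Finset.induction_on with
  | empty => exact fun f _ hf => h f fun i => hf i (by simp)
  | insert i s his ih =>
    intro f hf hf'
    have key : ∀ x ∈ Subgroup.closure (S i), MilnorSymbol (update f i x) ∈ B := by
      have h1 : MilnorSymbol (update f i 1) = 0 := by
        have := symbol_update_mul f i 1 1
        rw [mul_one] at this
        exact left_eq_add.1 this
      intro x hx
      induction hx using Subgroup.closure_induction with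
      | mem x hx =>
        refine ih _ (fun j hj => ?_) fun j hj => ?_
        · rw [update_of_ne (by rintro rfl; exact his hj)]
          exact hf j (Finset.mem_insert_of_mem hj)
        · rcases eq_or_ne j i with rfl | hji
          · simpa using hx
          · rw [update_of_ne hji]
            exact hf' j (by simp [hji, hj])
      | one => rw [h1]; exact zero_mem _
      | mul x y _ _ hx hy => rw [symbol_update_mul]; exact add_mem hx hy
      | inv x _ hx =>
        have := symbol_update_mul f i x⁻¹ x
        rw [inv_mul_cancel, h1] at this
        rw [eq_neg_of_add_eq_zero_left this.symm]
        exact neg_mem hx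
    simpa using key (f i) (hf i (by simp))

end CommRing

/-- A bimultiplicative pairing on the units of a field satisfying the Steinberg relation. -/
structure IsSteinberg {K : Type*} [Field K] {A : Type*} [AddCommGroup A]
    (B : Kˣ → Kˣ → A) : Prop where
  mul_left : ∀ a a' b, B (a * a') b = B a b + B a' b
  mul_right : ∀ a b b', B a (b * b') = B a b + B a b'
  eq_zero : ∀ a b : Kˣ, (a : K) + b = 1 → B a b = 0

namespace IsSteinberg

variable {K : Type*} [Field K] {A : Type*} [AddCommGroup A] {B : Kˣ → Kˣ → A}

theorem one_left (h : IsSteinberg B) (b : Kˣ) : B 1 b = 0 := by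
  simpa using h.mul_left 1 1 b

theorem one_right (h : IsSteinberg B) (a : Kˣ) : B a 1 = 0 := by
  simpa using h.mul_right a 1 1

theorem inv_left (h : IsSteinberg B) (a b : Kˣ) : B a⁻¹ b = -B a b :=
  eq_neg_of_add_eq_zero_left (by rw [← h.mul_left, inv_mul_cancel, h.one_left])

theorem inv_right (h : IsSteinberg B) (a b : Kˣ) : B a b⁻¹ = -B a b :=
  eq_neg_of_add_eq_zero_left (by rw [← h.mul_right, inv_mul_cancel, h.one_right])

theorem self_neg (h : IsSteinberg B) (a : Kˣ) : B a (-a) = 0 := by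
  rcases eq_or_ne a 1 with rfl | ha
  · exact h.one_left _
  have ha0 : (a : K) ≠ 0 := a.ne_zero
  have ha1 : (a : K) ≠ 1 := fun h => ha (Units.ext h)
  have hb : (1 : K) - a ≠ 0 := sub_ne_zero.2 ha1.symm
  have hc : (1 : K) - (a : K)⁻¹ ≠ 0 := sub_ne_zero.2 fun h => ha1 (inv_eq_one.1 h.symm)
  have hdiv : -a = Units.mk0 _ hb * (Units.mk0 _ hc)⁻¹ := by
    ext
    push_cast
    simp only [Units.val_mk0]
    rw [eq_mul_inv_iff_mul_eq₀ hc]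
    field_simp
    ring
  have h1 := h.eq_zero a (Units.mk0 _ hb) (by simp)
  have h2 := h.eq_zero a⁻¹ (Units.mk0 _ hc) (by simp)
  rw [h.inv_left] at h2
  rw [hdiv, h.mul_right, h.inv_right, h1, h2, add_zero]

theorem self_self (h : IsSteinberg B) (a : Kˣ) : B a a = B a (-1) := by
  have h1 := h.mul_right a (-a) (-1)
  rwa [h.self_neg, zero_add, neg_mul_neg, mul_one] at h1

theorem antisymm (h : IsSteinberg B) (a b : Kˣ) : B a b = -B b a := by
  have h1 := h.self_neg (a * b)
  rw [h.mul_left, ← neg_mul, h.mul_right, h.self_neg, zero_add, neg_mul, ← mul_neg, h.mul_right,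
    h.self_neg, add_zero] at h1
  exact eq_neg_of_add_eq_zero_left h1

theorem eq_of_sub (h : IsSteinberg B) {a b c : Kˣ} (habc : (a : K) - b = c) :
    B a b = B a (-c) - B b (-c) + B b (-1) := by
  have h1 := h.eq_zero (a * b⁻¹) (-c * b⁻¹) (by
    push_cast
    rw [← habc, ← add_mul]
    simp)
  simp only [h.mul_left, h.mul_right, h.inv_left, h.inv_right, h.self_self b] at h1
  rw [← sub_eq_zero, ← neg_eq_zero, ← h1]
  abel

end IsSteinberg

section Field

variable {K : Type*} [Field K] {m : ℕ}

theorem isSteinberg_symbol_of (f : Fin m → Kˣ) {i j : Fin m} (hij : i ≠ j)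
    (h : ∀ f : Fin m → Kˣ, (f i : K) + f j = 1 → MilnorSymbol f = 0) :
    IsSteinberg fun a b => MilnorSymbol (update (update f i a) j b) where
  mul_left a a' b := by
    simp only [update_comm hij _ b f]
    exact symbol_update_mul _ _ _ _
  mul_right a b b' := symbol_update_mul _ _ _ _
  eq_zero a b hab := h _ (by simpa [update_of_ne hij] using hab)

theorem symbol_comp_swap_of_succ (f : Fin m → Kˣ) {i j : Fin m} (hij : (i : ℕ) + 1 = j) :
    MilnorSymbol (f ∘ Equiv.swap i j) = -MilnorSymbol f := by
  have hne : i ≠ j := by rintro rfl; omega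
  have h := (isSteinberg_symbol_of f hne fun f hf => symbol_eq_zero_of_succ f hij hf).antisymm
    (f j) (f i)
  rw [update_eq_self, update_eq_self] at h
  rw [← h, Equiv.comp_swap_eq_update, update_comm hne]

theorem symbol_comp_perm (f : Fin m → Kˣ) (σ : Equiv.Perm (Fin m)) :
    MilnorSymbol (f ∘ σ) = MilnorSymbol f ∨ MilnorSymbol (f ∘ σ) = -MilnorSymbol f := by
  cases m with
  | zero => left; congr; ext i; exact i.elim0
  | succ m =>
    have hσ : σ ∈ Submonoid.closure (Set.range fun i : Fin m => Equiv.swap i.castSucc i.succ) := by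
      rw [Equiv.Perm.mclosure_swap_castSucc_succ]
      trivial
    induction hσ using Submonoid.closure_induction generalizing f with
    | mem σ h =>
      obtain ⟨i, rfl⟩ := h
      exact Or.inr (symbol_comp_swap_of_succ f (by simp))
    | one => exact Or.inl rfl
    | mul σ τ _ _ hσ hτ =>
      rw [Equiv.Perm.coe_mul, ← comp_assoc]
      rcases hσ f with h | h <;> rcases hτ (f ∘ σ) with h' | h' <;> simp [h, h']

theorem symbol_comp_perm_mem_iff (B : AddSubgroup (MilnorK K m)) (f : Fin m → Kˣ)
    (σ : Equiv.Perm (Fin m)) : MilnorSymbol (f ∘ σ) ∈ B ↔ MilnorSymbol f ∈ B := by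
  rcases symbol_comp_perm f σ with h | h <;> simp [h]

theorem symbol_eq_zero (f : Fin m → Kˣ) {i j : Fin m} (hij : i ≠ j)
    (h : (f i : K) + f j = 1) : MilnorSymbol f = 0 := by
  obtain ⟨k, rfl⟩ : ∃ k, m = k + 2 := ⟨m - 2, by omega⟩
  set τ := Equiv.swap 0 i
  have hτ : τ j ≠ 0 := fun h => hij (by rw [← τ.injective.eq_iff, h]; simp [τ])
  set σ : Equiv.Perm (Fin (k + 2)) := τ * Equiv.swap 1 (τ j)
  have h0 : σ 0 = i := by
    rw [Equiv.Perm.mul_apply, Equiv.swap_apply_of_ne_of_ne (by simp) hτ.symm]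
    simp [τ]
  have h1 : σ 1 = j := by
    rw [Equiv.Perm.mul_apply, Equiv.swap_apply_left]
    simp [τ]
  have h2 : MilnorSymbol (f ∘ σ) ∈ (⊥ : AddSubgroup (MilnorK K (k + 2))) := by
    rw [AddSubgroup.mem_bot]
    exact symbol_eq_zero_of_succ (i := 0) (j := 1) _ (by simp) (by simp [h0, h1, h])
  rwa [symbol_comp_perm_mem_iff] at h2

theorem isSteinberg_symbol (f : Fin m → Kˣ) {i j : Fin m} (hij : i ≠ j) :
    IsSteinberg fun a b => MilnorSymbol (update (update f i a) j b) :=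
  isSteinberg_symbol_of f hij fun f => symbol_eq_zero f hij

end Field

section RatFunc

variable {F : Type*} [Field F]

theorem num_leadingCoeff_mul {f : RatFunc F} {p q : F[X]} (hq : q ≠ 0)
    (h : f = algebraMap F[X] (RatFunc F) p / algebraMap F[X] (RatFunc F) q) :
    f.num.leadingCoeff * q.leadingCoeff = p.leadingCoeff := by
  have h1 : f.num * q = p * f.denom := by
    rw [RatFunc.num_mul_eq_mul_denom_iff hq]
    exact h
  have h2 := congrArg leadingCoeff h1
  rwa [leadingCoeff_mul, leadingCoeff_mul, (RatFunc.monic_denom f).leadingCoeff, mul_one] at h2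

/-- The leading coefficient of a nonzero rational function, as a homomorphism. -/
noncomputable def leadingCoeffHom (F : Type*) [Field F] : (RatFunc F)ˣ →* Fˣ where
  toFun f := Units.mk0 (f : RatFunc F).num.leadingCoeff (by simp)
  map_one' := by ext; simp
  map_mul' f g := by
    ext
    have h := num_leadingCoeff_mul (f := (f : RatFunc F) * (g : RatFunc F))
      (p := (f : RatFunc F).num * (g : RatFunc F).num)
      (q := (f : RatFunc F).denom * (g : RatFunc F).denom)
      (mul_ne_zero (RatFunc.denom_ne_zero _) (RatFunc.denom_ne_zero _)) (by
        rw [map_mul, map_mul, ← div_mul_div_comm, RatFunc.num_div_denom, RatFunc.num_div_denom])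
    simpa [leadingCoeff_mul, (RatFunc.monic_denom _).leadingCoeff] using h

theorem leadingCoeffHom_val (f : (RatFunc F)ˣ) :
    (leadingCoeffHom F f : F) = (f : RatFunc F).num.leadingCoeff := rfl

theorem leadingCoeffHom_add_eq_one {f g : (RatFunc F)ˣ} (h : (f : RatFunc F) + g = 1) :
    leadingCoeffHom F f = 1 ∨ leadingCoeffHom F g = 1 ∨
      leadingCoeffHom F g = -leadingCoeffHom F f ∨
      (leadingCoeffHom F f : F) + leadingCoeffHom F g = 1 := by
  set p := (f : RatFunc F).num with hp
  set q := (f : RatFunc F).denom with hq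
  have hq0 : q ≠ 0 := RatFunc.denom_ne_zero _
  have hqm : q.leadingCoeff = 1 := (RatFunc.monic_denom _).leadingCoeff
  have hg : (g : RatFunc F).num.leadingCoeff = (q - p).leadingCoeff := by
    have h1 := num_leadingCoeff_mul (f := (g : RatFunc F)) (p := q - p) (q := q) hq0 (by
      rw [map_sub, sub_div, div_self (RatFunc.algebraMap_ne_zero hq0), RatFunc.num_div_denom, ← h]
      ring)
    rwa [hqm, mul_one] at h1
  simp only [Units.ext_iff, leadingCoeffHom_val, Units.val_neg, Units.val_one, hg, ← hp]
  rcases lt_trichotomy p.degree q.degree with hd | hd | hd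
  · right; left
    rw [leadingCoeff_sub_of_degree_lt hd, hqm]
  · by_cases hpq : q.leadingCoeff = p.leadingCoeff
    · left
      rw [← hpq, hqm]
    · right; right; right
      rw [leadingCoeff_sub_of_degree_eq hd.symm hpq, hqm]
      ring
  · right; right; left
    rw [leadingCoeff_sub_of_degree_lt' hd]

/-- The retraction of `K^M(F) → K^M(F(t))` given by leading coefficients. -/
noncomputable def specialize (F : Type*) [Field F] (n : ℕ) : MilnorK (RatFunc F) n →+ MilnorK F n :=
  lift (fun f => MilnorSymbol (leadingCoeffHom F ∘ f))
    (fun f i a b => by simp only [comp_update, map_mul, symbol_update_mul])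
    (fun f i j hij h => by
      have hne : i ≠ j := by rintro rfl; omega
      have hB := isSteinberg_symbol (leadingCoeffHom F ∘ f) hne
      have hf : MilnorSymbol (leadingCoeffHom F ∘ f) = MilnorSymbol (update (update
          (leadingCoeffHom F ∘ f) i (leadingCoeffHom F (f i))) j (leadingCoeffHom F (f j))) := by
        congr 1
        ext k
        by_cases hk : k = j
        · subst hk; simp
        · by_cases hk' : k = i
          · subst hk'; simp [hk]
          · simp [hk, hk']
      rw [hf]
      rcases leadingCoeffHom_add_eq_one h with h | h | h | h
      · rw [h]; exact hB.one_left _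
      · rw [h]; exact hB.one_right _
      · rw [h]; exact hB.self_neg _
      · exact hB.eq_zero _ _ h)

theorem specialize_symbol {n : ℕ} (f : Fin n → (RatFunc F)ˣ) :
    specialize F n (MilnorSymbol f) = MilnorSymbol (leadingCoeffHom F ∘ f) :=
  lift_symbol _ _ _ f

/-- The units of `F(t)` generated by the nonzero polynomials of degree less than `d`. -/
noncomputable def lowUnits (F : Type*) [Field F] (d : ℕ) : Subgroup (RatFunc F)ˣ :=
  Subgroup.closure {u | ∃ p : F[X], p.natDegree < d ∧ (u : RatFunc F) = algebraMap F[X] _ p}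

/-- The subgroup of Milnor K-theory of `F(t)` generated by symbols in polynomials of degree
less than `d`. -/
noncomputable def lowDegree (F : Type*) [Field F] (n d : ℕ) : AddSubgroup (MilnorK (RatFunc F) n) :=
  AddSubgroup.closure {z | ∃ f : Fin n → (RatFunc F)ˣ,
    (∀ i, f i ∈ lowUnits F d) ∧ z = MilnorSymbol f}

theorem mem_lowUnits {d : ℕ} {p : F[X]} (hp : p.natDegree < d) {u : (RatFunc F)ˣ}
    (hu : (u : RatFunc F) = algebraMap F[X] _ p) : u ∈ lowUnits F d :=
  Subgroup.subset_closure ⟨p, hp, hu⟩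

theorem neg_mem_lowUnits {d : ℕ} (hd : 0 < d) {u : (RatFunc F)ˣ} (hu : u ∈ lowUnits F d) :
    -u ∈ lowUnits F d := by
  rw [← neg_one_mul]
  exact mul_mem (mem_lowUnits (p := C (-1)) (by simpa using hd) (by simp)) hu

theorem lowUnits_mono {d e : ℕ} (h : d ≤ e) : lowUnits F d ≤ lowUnits F e :=
  Subgroup.closure_mono fun _ ⟨p, hp, hu⟩ => ⟨p, hp.trans_le h, hu⟩

theorem symbol_mem_lowDegree {n d : ℕ} {f : Fin n → (RatFunc F)ˣ}
    (hf : ∀ i, f i ∈ lowUnits F d) : MilnorSymbol f ∈ lowDegree F n d :=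
  AddSubgroup.subset_closure ⟨f, hf, rfl⟩

theorem lowDegree_mono (n : ℕ) {d e : ℕ} (h : d ≤ e) : lowDegree F n d ≤ lowDegree F n e :=
  AddSubgroup.closure_mono fun _ ⟨f, hf, hz⟩ => ⟨f, fun i => lowUnits_mono h (hf i), hz⟩

theorem lowDegree_le {n d : ℕ} {B : AddSubgroup (MilnorK (RatFunc F) n)}
    (h : ∀ f : Fin n → (RatFunc F)ˣ,
      (∀ i, ∃ p : F[X], p.natDegree < d ∧ (f i : RatFunc F) = algebraMap F[X] _ p) →
      MilnorSymbol f ∈ B) : lowDegree F n d ≤ B := by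
  rw [lowDegree, AddSubgroup.closure_le]
  rintro _ ⟨f, hf, rfl⟩
  exact symbol_mem_of_closure h f hf

theorem exists_mem_lowUnits (u : (RatFunc F)ˣ) : ∃ d, u ∈ lowUnits F d := by
  have hn : algebraMap F[X] (RatFunc F) (u : RatFunc F).num ≠ 0 :=
    RatFunc.algebraMap_ne_zero (RatFunc.num_ne_zero u.ne_zero)
  have hm : algebraMap F[X] (RatFunc F) (u : RatFunc F).denom ≠ 0 :=
    RatFunc.algebraMap_ne_zero (RatFunc.denom_ne_zero _)
  have h : u = Units.mk0 _ hn * (Units.mk0 _ hm)⁻¹ := by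
    ext
    simp only [Units.val_mul, Units.val_inv_eq_inv_val, Units.val_mk0]
    rw [← div_eq_mul_inv, RatFunc.num_div_denom]
  have hmem := mul_mem
    (mem_lowUnits (Nat.lt_succ_of_le (le_max_left _ (u : RatFunc F).denom.natDegree))
      (Units.val_mk0 hn))
    (inv_mem (mem_lowUnits (Nat.lt_succ_of_le (le_max_right (u : RatFunc F).num.natDegree _))
      (Units.val_mk0 hm)))
  rw [← h] at hmem
  exact ⟨_, hmem⟩

theorem exists_mem_lowDegree {n : ℕ} (z : MilnorK (RatFunc F) n) : ∃ d, z ∈ lowDegree F n d := by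
  have hz : z ∈ AddSubgroup.closure (Set.range (MilnorSymbol (R := RatFunc F) (n := n))) := by
    rw [closure_range_symbol]
    trivial
  induction hz using AddSubgroup.closure_induction with
  | mem z h =>
    obtain ⟨f, rfl⟩ := h
    choose d hd using fun i => exists_mem_lowUnits (f i)
    exact ⟨Finset.univ.sup d, symbol_mem_lowDegree fun i =>
      lowUnits_mono (Finset.le_sup (Finset.mem_univ i)) (hd i)⟩
  | zero => exact ⟨0, zero_mem _⟩
  | add x y _ _ hx hy =>
    obtain ⟨d, hd⟩ := hx
    obtain ⟨e, he⟩ := hy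
    exact ⟨max d e, add_mem (lowDegree_mono n (le_max_left _ _) hd)
      (lowDegree_mono n (le_max_right _ _) he)⟩
  | neg x _ hx =>
    obtain ⟨d, hd⟩ := hx
    exact ⟨d, neg_mem hd⟩

/-- The units of `F(t)` given by monic irreducible polynomials of degree `d`. -/
def IsPrimeUnit (d : ℕ) (u : (RatFunc F)ˣ) : Prop :=
  ∃ p : F[X], p.Monic ∧ Irreducible p ∧ p.natDegree = d ∧ (u : RatFunc F) = algebraMap F[X] _ p

theorem lowUnits_succ_le {d : ℕ} (hd : 0 < d) :
    lowUnits F (d + 1) ≤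
      Subgroup.closure {u | u ∈ lowUnits F d ∨ IsPrimeUnit d u} := by
  set T := Subgroup.closure {u : (RatFunc F)ˣ | u ∈ lowUnits F d ∨ IsPrimeUnit d u}
  have hT : ∀ u ∈ lowUnits F d, u ∈ T := fun u hu => Subgroup.subset_closure (Or.inl hu)
  rw [lowUnits, Subgroup.closure_le]
  rintro u ⟨p, hp, hu⟩
  have hp0 : p ≠ 0 := by
    rintro rfl
    exact u.ne_zero (by rw [hu, map_zero])
  rcases (Nat.lt_succ_iff_lt_or_eq.1 hp) with hlt | heq
  · exact hT u (mem_lowUnits hlt hu)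
  · by_cases hirr : Irreducible p
    · have hl : p.leadingCoeff ≠ 0 := leadingCoeff_ne_zero.2 hp0
      have hc : algebraMap F[X] (RatFunc F) (C p.leadingCoeff) ≠ 0 :=
        RatFunc.algebraMap_ne_zero (C_ne_zero.2 hl)
      have hm : algebraMap F[X] (RatFunc F) (p * C p.leadingCoeff⁻¹) ≠ 0 :=
        RatFunc.algebraMap_ne_zero (mul_ne_zero hp0 (C_ne_zero.2 (inv_ne_zero hl)))
      have hu' : u = Units.mk0 _ hc * Units.mk0 _ hm := by
        ext
        simp only [Units.val_mul, Units.val_mk0, hu]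
        rw [← map_mul, mul_left_comm, ← C_mul, mul_inv_cancel₀ hl, C_1, mul_one]
      rw [hu']
      refine mul_mem (hT _ (mem_lowUnits (by simpa using hd) rfl))
        (Subgroup.subset_closure (Or.inr ⟨_, monic_mul_leadingCoeff_inv hp0,
          irreducible_mul_leadingCoeff_inv.2 hirr, ?_, rfl⟩))
      rw [natDegree_mul_leadingCoeff_inv _ hp0, heq]
    · have hnu : ¬IsUnit p := fun h => by
        have := natDegree_eq_zero_of_isUnit h
        omega
      obtain ⟨a, b, ha, hb, rfl⟩ : ∃ a b : F[X], ¬IsUnit a ∧ ¬IsUnit b ∧ p = a * b := by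
        by_contra! H
        exact hirr ⟨hnu, fun a b hab => by
          by_contra! h
          exact H a b h.1 h.2 hab⟩
      have ha0 : a ≠ 0 := left_ne_zero_of_mul hp0
      have hb0 : b ≠ 0 := right_ne_zero_of_mul hp0
      have hda : a.natDegree ≠ 0 := fun h => ha (isUnit_iff_degree_eq_zero.2 (by
        rw [degree_eq_natDegree ha0, h]; rfl))
      have hdb : b.natDegree ≠ 0 := fun h => hb (isUnit_iff_degree_eq_zero.2 (by
        rw [degree_eq_natDegree hb0, h]; rfl))
      rw [natDegree_mul ha0 hb0] at heq
      have hu' : u = Units.mk0 _ (RatFunc.algebraMap_ne_zero ha0) *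
          Units.mk0 _ (RatFunc.algebraMap_ne_zero hb0) := by
        ext
        simp [hu]
      rw [hu']
      exact mul_mem (hT _ (mem_lowUnits (by omega) rfl)) (hT _ (mem_lowUnits (by omega) rfl))

/-- Membership of `lowDegree F (n + 1) (d + 1)` in a subgroup is checked on symbols in which a
monic irreducible polynomial of degree `d` is followed by polynomials of smaller degree, and on
`lowDegree F (n + 1) d`. -/
theorem lowDegree_succ_le {n d : ℕ} (hd : 0 < d) {B : AddSubgroup (MilnorK (RatFunc F) (n + 1))}
    (hlow : lowDegree F (n + 1) d ≤ B)
    (hprime : ∀ f : Fin (n + 1) → (RatFunc F)ˣ, IsPrimeUnit d (f 0) →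
      (∀ i : Fin n, ∃ p : F[X], p.natDegree < d ∧ (f i.succ : RatFunc F) = algebraMap F[X] _ p) →
      MilnorSymbol f ∈ B) :
    lowDegree F (n + 1) (d + 1) ≤ B := by
  have hprime' : ∀ f : Fin (n + 1) → (RatFunc F)ˣ, IsPrimeUnit d (f 0) →
      (∀ i : Fin n, f i.succ ∈ lowUnits F d) → MilnorSymbol f ∈ B := by
    intro f h0 hf
    refine symbol_mem_of_closure (S := Fin.cons {u | IsPrimeUnit d u} fun _ =>
      {u : (RatFunc F)ˣ | ∃ p : F[X], p.natDegree < d ∧ (u : RatFunc F) = algebraMap F[X] _ p})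
      (fun g hg => hprime g (hg 0) fun i => hg i.succ) f fun i => ?_
    refine Fin.cases ?_ (fun i => ?_) i
    · exact Subgroup.subset_closure h0
    · exact hf i
  have key : ∀ (k : ℕ) (f : Fin (n + 1) → (RatFunc F)ˣ),
      (∀ i, f i ∈ lowUnits F d ∨ IsPrimeUnit d (f i)) →
      {i | f i ∉ lowUnits F d}.ncard ≤ k → MilnorSymbol f ∈ B := by
    intro k
    induction k with
    | zero =>
      intro f hf hk
      have h0 : {i | f i ∉ lowUnits F d} = ∅ := by
        rw [← Set.ncard_eq_zero]
        exact Nat.le_zero.1 hk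
      refine hlow (symbol_mem_lowDegree fun i => ?_)
      by_contra hi
      exact (h0 ▸ (show i ∈ {i | f i ∉ lowUnits F d} from hi) : i ∈ (∅ : Set (Fin (n + 1))))
    | succ k ih =>
      intro f hf hk
      by_cases hex : ∃ i, f i ∉ lowUnits F d
      swap
      · push Not at hex
        exact hlow (symbol_mem_lowDegree hex)
      obtain ⟨i, hi⟩ := hex
      by_cases hex' : ∃ j, j ≠ i ∧ f j ∉ lowUnits F d
      · obtain ⟨j, hji, hj⟩ := hex'
        obtain ⟨p, hpm, hpi, hpd, hp⟩ := (hf i).resolve_left hi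
        obtain ⟨q, hqm, hqi, hqd, hq⟩ := (hf j).resolve_left hj
        have hst := isSteinberg_symbol f hji.symm
        have hfB : MilnorSymbol f = MilnorSymbol (update (update f i (f i)) j (f j)) := by simp
        have hmem : ∀ x y, (x ∈ lowUnits F d ∨ IsPrimeUnit d x) → y ∈ lowUnits F d →
            MilnorSymbol (update (update f i x) j y) ∈ B := by
          intro x y hx hy
          refine ih _ (fun l => ?_) ?_
          · by_cases hlj : l = j
            · subst hlj; simp [hy]
            · by_cases hli : l = i
              · subst hli; simpa [hlj] using hx
              · simpa [hlj, hli] using hf l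
          · rw [← Nat.lt_succ_iff]
            refine lt_of_lt_of_le (Set.ncard_lt_ncard ?_) hk
            refine ⟨fun l hl => ?_, fun h => ?_⟩
            · by_cases hlj : l = j
              · subst hlj; exact hj
              · by_cases hli : l = i
                · subst hli; exact hi
                · simpa [hlj, hli] using hl
            · have := h hj
              simp [hy] at this
        have hneg : (-1 : (RatFunc F)ˣ) ∈ lowUnits F d := neg_mem_lowUnits hd (one_mem _)
        rw [hfB]
        by_cases hpq : p = q
        · have : f j = f i := Units.ext (by rw [hp, hq, hpq])
          rw [this, hst.self_self]
          exact hmem _ _ (hf i) hneg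
        · have hlt : (p - q).natDegree < d := by
            have h1 : (p - q).degree < p.degree := degree_sub_lt_left
              (by rw [degree_eq_natDegree hpm.ne_zero, degree_eq_natDegree hqm.ne_zero, hpd, hqd])
              hpm.ne_zero (by rw [hpm.leadingCoeff, hqm.leadingCoeff])
            rw [← hpd]
            exact natDegree_lt_natDegree (sub_ne_zero.2 hpq) h1
          set c := Units.mk0 _ (RatFunc.algebraMap_ne_zero (K := F) (sub_ne_zero.2 hpq)) with hc
          have hcl : -c ∈ lowUnits F d := neg_mem_lowUnits hd (mem_lowUnits hlt rfl)
          rw [hst.eq_of_sub (c := c) (by rw [hp, hq, hc, Units.val_mk0, map_sub])]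
          exact add_mem (sub_mem (hmem _ _ (hf i) hcl) (hmem _ _ (hf j) hcl))
            (hmem _ _ (hf j) hneg)
      · push Not at hex'
        rw [← symbol_comp_perm_mem_iff B f (Equiv.swap 0 i)]
        refine hprime' _ ?_ fun l => ?_
        · simpa using (hf i).resolve_left hi
        · refine hex' _ fun h => ?_
          rw [Equiv.swap_apply_eq_iff, Equiv.swap_apply_right] at h
          exact Fin.succ_ne_zero l h
  rw [lowDegree, AddSubgroup.closure_le]
  rintro _ ⟨f, hf, rfl⟩
  exact symbol_mem_of_closure (S := fun _ => {u | u ∈ lowUnits F d ∨ IsPrimeUnit d u})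
    (fun g hg => key _ g hg le_rfl) f fun i => lowUnits_succ_le hd (hf i)

theorem isCoprime_of_natDegree_lt {π p : F[X]} (hirr : Irreducible π) (hp0 : p ≠ 0)
    (hp : p.natDegree < π.natDegree) : IsCoprime p π :=
  ((hirr.coprime_iff_not_dvd).2 fun h => hp0 (eq_zero_of_dvd_of_natDegree_lt h hp)).symm

theorem isUnit_mk_of_isCoprime {π p : F[X]} (h : IsCoprime p π) :
    IsUnit (Ideal.Quotient.mk (Ideal.span {π}) p) := by
  obtain ⟨a, b, hab⟩ := h
  refine IsUnit.of_mul_eq_one_right (Ideal.Quotient.mk _ a) ?_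
  rw [← map_mul, ← map_one (Ideal.Quotient.mk (Ideal.span {π})), Ideal.Quotient.mk_eq_mk_iff_sub_mem,
    Ideal.mem_span_singleton, ← hab]
  exact ⟨-b, by ring⟩

/-- The representative of smallest degree of a residue class modulo `π`. -/
noncomputable def residueRep (π : F[X]) (v : F[X] ⧸ Ideal.span {π}) : F[X] :=
  Quotient.out v %ₘ π

section Residue

variable {π : F[X]} {d : ℕ}

theorem mk_residueRep (v : F[X] ⧸ Ideal.span {π}) :
    Ideal.Quotient.mk _ (residueRep π v) = v := by
  conv_rhs => rw [← Quotient.out_eq v]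
  refine (Ideal.Quotient.mk_eq_mk_iff_sub_mem _ _).2 (Ideal.mem_span_singleton.2 ?_)
  rw [residueRep, modByMonic_eq_sub_mul_div _ π]
  exact ⟨-(Quotient.out v /ₘ π), by ring⟩

theorem natDegree_residueRep_lt (hm : π.Monic) (hπ : π.natDegree = d) (hd : 0 < d)
    (v : F[X] ⧸ Ideal.span {π}) : (residueRep π v).natDegree < d := by
  rw [← hπ]
  exact natDegree_modByMonic_lt _ hm (by rintro rfl; simp at hπ; omega)

theorem mk_injOn {p q : F[X]} (hp : p.natDegree < π.natDegree) (hq : q.natDegree < π.natDegree)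
    (h : Ideal.Quotient.mk (Ideal.span {π}) p = Ideal.Quotient.mk (Ideal.span {π}) q) : p = q := by
  rw [Ideal.Quotient.mk_eq_mk_iff_sub_mem, Ideal.mem_span_singleton] at h
  exact sub_eq_zero.1 (eq_zero_of_dvd_of_natDegree_lt h
    ((natDegree_sub_le _ _).trans_lt (max_lt hp hq)))

theorem residueRep_mk (hm : π.Monic) (hπ : π.natDegree = d) (hd : 0 < d) {p : F[X]}
    (hp : p.natDegree < d) : residueRep π (Ideal.Quotient.mk _ p) = p :=
  mk_injOn (hπ ▸ natDegree_residueRep_lt hm hπ hd _) (hπ ▸ hp) (mk_residueRep _)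

theorem residueRep_ne_zero (hirr : Irreducible π)
    (v : (F[X] ⧸ Ideal.span {π})ˣ) : residueRep π v ≠ 0 := by
  intro h
  have h1 := mk_residueRep (v : F[X] ⧸ Ideal.span {π})
  have : Nontrivial (F[X] ⧸ Ideal.span {π}) := by
    rw [Ideal.Quotient.nontrivial_iff, Ne, Ideal.span_singleton_eq_top]
    exact hirr.not_isUnit
  rw [h, map_zero] at h1
  exact v.ne_zero h1.symm

/-- The unit of `F(t)` given by the reduced representative of a unit modulo `π`. -/
noncomputable def residueUnit (hirr : Irreducible π)
    (v : (F[X] ⧸ Ideal.span {π})ˣ) : (RatFunc F)ˣ :=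
  Units.mk0 _ (RatFunc.algebraMap_ne_zero (residueRep_ne_zero hirr v))

/-- A nonzero polynomial as a unit of `F(t)`. -/
noncomputable def polyUnit {p : F[X]} (hp : p ≠ 0) : (RatFunc F)ˣ :=
  Units.mk0 _ (RatFunc.algebraMap_ne_zero hp)

theorem residueUnit_mem_lowUnits (hm : π.Monic) (hirr : Irreducible π) (hπ : π.natDegree = d)
    (hd : 0 < d) (v : (F[X] ⧸ Ideal.span {π})ˣ) : residueUnit hirr v ∈ lowUnits F d :=
  mem_lowUnits (natDegree_residueRep_lt hm hπ hd _) rfl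

/-- Multiplying out reduced representatives modulo `π`, paired with `π`, is harmless up to the
pairing of units of low degree. -/
theorem IsSteinberg.residueUnit_mul {A : Type*} [AddCommGroup A] {C : AddSubgroup A}
    {B : (RatFunc F)ˣ → (RatFunc F)ˣ → A} (hB : IsSteinberg B)
    (hm : π.Monic) (hirr : Irreducible π) (hπ : π.natDegree = d) (hd : 0 < d)
    (hC : ∀ x ∈ lowUnits F d, ∀ y ∈ lowUnits F d, B x y ∈ C)
    (a b : (F[X] ⧸ Ideal.span {π})ˣ) :
    B (polyUnit hm.ne_zero) (residueUnit hirr (a * b)) -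
      (B (polyUnit hm.ne_zero) (residueUnit hirr a) +
        B (polyUnit hm.ne_zero) (residueUnit hirr b)) ∈ C := by
  set p := residueRep π (a : F[X] ⧸ Ideal.span {π}) with hp
  set q := residueRep π (b : F[X] ⧸ Ideal.span {π}) with hq
  set r := residueRep π ((a * b : (F[X] ⧸ Ideal.span {π})ˣ) : F[X] ⧸ Ideal.span {π}) with hr
  have hpd : p.natDegree < d := natDegree_residueRep_lt hm hπ hd _
  have hqd : q.natDegree < d := natDegree_residueRep_lt hm hπ hd _
  have hrd : r.natDegree < d := natDegree_residueRep_lt hm hπ hd _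
  have hdvd : π ∣ p * q - r := by
    rw [← Ideal.mem_span_singleton, ← Ideal.Quotient.mk_eq_mk_iff_sub_mem, map_mul,
      mk_residueRep, mk_residueRep, mk_residueRep, Units.val_mul]
  obtain ⟨s, hs⟩ := hdvd
  set y := residueUnit hirr a
  set z := residueUnit hirr b
  set w := residueUnit hirr (a * b)
  set P := polyUnit hm.ne_zero
  have hy : (y : RatFunc F) = algebraMap F[X] _ p := rfl
  have hz : (z : RatFunc F) = algebraMap F[X] _ q := rfl
  have hw : (w : RatFunc F) = algebraMap F[X] _ r := rfl
  have hP : (P : RatFunc F) = algebraMap F[X] _ π := rfl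
  have hyzw : (y : RatFunc F) * z - w = algebraMap F[X] _ π * algebraMap F[X] _ s := by
    rw [hy, hz, hw, ← map_mul, ← map_sub, hs, map_mul]
  by_cases hs0 : s = 0
  · have : w = y * z := by
      ext
      rw [hs0, map_zero, mul_zero] at hyzw
      rw [Units.val_mul, sub_eq_zero.1 hyzw]
    rw [this, hB.mul_right, sub_self]
    exact zero_mem _
  have hsd : s.natDegree < d := by
    have h1 : (π * s).natDegree = d + s.natDegree := by rw [natDegree_mul hm.ne_zero hs0, hπ]
    have h2 : (p * q - r).natDegree ≤ max (p.natDegree + q.natDegree) r.natDegree :=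
      (natDegree_sub_le _ _).trans (max_le_max_right _ natDegree_mul_le)
    rw [hs, h1] at h2
    omega
  set S := polyUnit hs0
  have hS : (S : RatFunc F) = algebraMap F[X] _ s := rfl
  have hyl : y ∈ lowUnits F d := mem_lowUnits hpd hy
  have hzl : z ∈ lowUnits F d := mem_lowUnits hqd hz
  have hwl : w ∈ lowUnits F d := mem_lowUnits hrd hw
  have hSl : S ∈ lowUnits F d := mem_lowUnits hsd hS
  have h1 := hB.eq_zero (P * (S * (y * z)⁻¹)) (w * (y * z)⁻¹) (by
    push_cast
    rw [hP, hS, ← mul_assoc, ← hyzw, ← add_mul, sub_add_cancel, ← Units.val_mul]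
    simp only [← Units.val_inv_eq_inv_val, ← Units.val_mul]
    simp)
  rw [hB.mul_left, hB.mul_right P, hB.inv_right, hB.mul_right P y, ← sub_eq_add_neg] at h1
  rw [eq_neg_of_add_eq_zero_left h1]
  exact neg_mem (hC _ (mul_mem hSl (inv_mem (mul_mem hyl hzl))) _
    (mul_mem hwl (inv_mem (mul_mem hyl hzl))))

/-- The homomorphism `K_n(F[t]/(π)) → K_{n+1}(F(t)) / L` with `{v₁, …} ↦ {π, v₁, …}`, where `L` is
generated by symbols in polynomials of degree less than that of `π`. -/
noncomputable def transfer (n : ℕ) (hm : π.Monic) (hirr : Irreducible π) (hπ : π.natDegree = d)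
    (hd : 0 < d) :
    MilnorK (F[X] ⧸ Ideal.span {π}) n →+ MilnorK (RatFunc F) (n + 1) ⧸ lowDegree F (n + 1) d :=
  lift (fun v => QuotientAddGroup.mk (MilnorSymbol
      (Fin.cons (polyUnit hm.ne_zero) (residueUnit hirr ∘ v) : Fin (n + 1) → (RatFunc F)ˣ)))
    (fun v i a b => by
      set g : Fin (n + 1) → (RatFunc F)ˣ :=
        Fin.cons (polyUnit hm.ne_zero) (residueUnit hirr ∘ v)
      have hB := isSteinberg_symbol g (Fin.succ_ne_zero i).symm
      have hg : ∀ x, (Fin.cons (polyUnit hm.ne_zero) (residueUnit hirr ∘ update v i x) :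
          Fin (n + 1) → (RatFunc F)ˣ) =
          update (update g 0 (polyUnit hm.ne_zero)) i.succ (residueUnit hirr x) := by
        intro x
        have hg0 : update g 0 (polyUnit hm.ne_zero) = g := update_eq_self 0 g
        rw [comp_update, Fin.cons_update, hg0]
      have h := hB.residueUnit_mul hm hirr hπ hd (C := lowDegree F (n + 1) d)
        (fun x hx y hy => symbol_mem_lowDegree fun l => by
          by_cases hl : l = i.succ
          · subst hl; simpa using hy
          · rw [update_of_ne hl]
            induction l using Fin.cases with
            | zero => simpa using hx
            | succ l =>
              rw [update_of_ne (Fin.succ_ne_zero l)]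
              exact residueUnit_mem_lowUnits hm hirr hπ hd (v l)) a b
      rw [hg, hg, hg, ← QuotientAddGroup.mk_add, ← sub_eq_zero, ← QuotientAddGroup.mk_sub]
      exact (QuotientAddGroup.eq_zero_iff _).2 h)
    (fun v i j hij h => by
      rw [symbol_eq_zero_of_succ (i := i.succ) (j := j.succ) _ (by simpa using hij),
        QuotientAddGroup.mk_zero]
      change algebraMap F[X] (RatFunc F) _ + algebraMap F[X] (RatFunc F) _ = 1
      rw [← map_add, ← map_one (algebraMap F[X] (RatFunc F))]
      congr 1
      have hlt := fun v => natDegree_residueRep_lt hm hπ hd v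
      refine mk_injOn (π := π) ?_ (by rw [hπ]; simpa using hd) ?_
      · rw [hπ]
        exact (natDegree_add_le _ _).trans_lt (max_lt (hlt _) (hlt _))
      · rw [map_add, mk_residueRep, mk_residueRep, h, map_one])

theorem transfer_symbol {n : ℕ} (hm : π.Monic) (hirr : Irreducible π) (hπ : π.natDegree = d)
    (hd : 0 < d) (v : Fin n → (F[X] ⧸ Ideal.span {π})ˣ) :
    transfer n hm hirr hπ hd (MilnorSymbol v) = QuotientAddGroup.mk (MilnorSymbol
      (Fin.cons (polyUnit hm.ne_zero) (residueUnit hirr ∘ v) : Fin (n + 1) → (RatFunc F)ˣ)) :=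
  lift_symbol _ _ _ v

theorem transfer_apply_tame {n : ℕ} (hm : π.Monic) (hirr : Irreducible π)
    (hπ : π.natDegree = d) (hd : 0 < d)
    {D : MilnorK (RatFunc F) (n + 1) →+ MilnorK (F[X] ⧸ Ideal.span {π}) n}
    (hD : IsTameSymbol F n π D) (f : Fin (n + 1) → (RatFunc F)ˣ)
    (h0 : (f 0 : RatFunc F) = algebraMap F[X] _ π)
    (hf : ∀ i : Fin n, ∃ p : F[X], p.natDegree < d ∧ (f i.succ : RatFunc F) = algebraMap F[X] _ p) :
    transfer n hm hirr hπ hd (D (MilnorSymbol f)) = QuotientAddGroup.mk (MilnorSymbol f) := by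
  choose p hpd hp using hf
  have hcop : ∀ i, IsCoprime (p i) π := fun i => isCoprime_of_natDegree_lt hirr
    (fun h => (f i.succ).ne_zero (by rw [hp, h, map_zero])) (hπ ▸ hpd i)
  rw [hD.1 p hcop f (fun i => (isUnit_mk_of_isCoprime (hcop i)).unit) h0 hp fun i => rfl,
    transfer_symbol]
  congr 2
  ext i
  induction i using Fin.cases with
  | zero => exact h0.symm
  | succ i =>
    rw [hp]
    change algebraMap F[X] (RatFunc F) (residueRep π (Ideal.Quotient.mk _ (p i))) = _
    rw [residueRep_mk hm hπ hd (hpd i)]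

theorem tame_eq_zero_of_mem_lowDegree {n : ℕ} (hirr : Irreducible π) (hπ : d ≤ π.natDegree)
    {D : MilnorK (RatFunc F) (n + 1) →+ MilnorK (F[X] ⧸ Ideal.span {π}) n}
    (hD : IsTameSymbol F n π D) {z : MilnorK (RatFunc F) (n + 1)} (hz : z ∈ lowDegree F (n + 1) d) :
    D z = 0 := by
  refine (lowDegree_le (B := D.ker) fun f hf => ?_) hz
  choose p hpd hp using hf
  exact hD.2 p (fun i => isCoprime_of_natDegree_lt hirr
    (fun h => (f i).ne_zero (by rw [hp, h, map_zero])) ((hpd i).trans_le hπ)) f hp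

end Residue

section Sequence

variable {n : ℕ}
  {D : ∀ q : F[X], MilnorK (RatFunc F) (n + 1) →+ MilnorK (F[X] ⧸ Ideal.span {q}) n}

theorem mem_lowDegree_of_tame_eq_zero
    (hD : ∀ q : F[X], q.Monic → Irreducible q → IsTameSymbol F n q (D q)) {d : ℕ} (hd : 0 < d)
    {z : MilnorK (RatFunc F) (n + 1)} (hz : z ∈ lowDegree F (n + 1) (d + 1))
    (hDz : ∀ q : F[X], q.Monic → Irreducible q → D q z = 0) : z ∈ lowDegree F (n + 1) d := by
  classical
  let P := {p : F[X] // p.Monic ∧ Irreducible p ∧ p.natDegree = d}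
  let ψ : P → MilnorK (RatFunc F) (n + 1) →+ MilnorK (RatFunc F) (n + 1) ⧸ lowDegree F (n + 1) d :=
    fun p => (transfer n p.2.1 p.2.2.1 p.2.2.2 hd).comp (D p.1)
  let B : AddSubgroup (MilnorK (RatFunc F) (n + 1)) :=
    { carrier := {z | ∃ s₀ : Finset P, ∀ s, s₀ ⊆ s → QuotientAddGroup.mk z = ∑ p ∈ s, ψ p z}
      zero_mem' := ⟨∅, fun s _ => by simp⟩
      add_mem' := by
        rintro x y ⟨s, hs⟩ ⟨t, ht⟩
        refine ⟨s ∪ t, fun r hr => ?_⟩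
        rw [QuotientAddGroup.mk_add, hs r (Finset.union_subset_left hr),
          ht r (Finset.union_subset_right hr)]
        simp [Finset.sum_add_distrib]
      neg_mem' := by
        rintro x ⟨s, hs⟩
        refine ⟨s, fun r hr => ?_⟩
        rw [QuotientAddGroup.mk_neg, hs r hr]
        simp }
  have hB : lowDegree F (n + 1) (d + 1) ≤ B := by
    refine lowDegree_succ_le hd (fun x hx => ⟨∅, fun s _ => ?_⟩) ?_
    · rw [(QuotientAddGroup.eq_zero_iff x).2 hx, Finset.sum_eq_zero]
      intro p _
      simp only [ψ, AddMonoidHom.comp_apply]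
      rw [tame_eq_zero_of_mem_lowDegree p.2.2.1 p.2.2.2.ge (hD _ p.2.1 p.2.2.1) hx, map_zero]
    · rintro f ⟨q, hqm, hqi, hqd, hq⟩ hf
      refine ⟨{⟨q, hqm, hqi, hqd⟩}, fun s hs => ?_⟩
      rw [Finset.sum_eq_single_of_mem ⟨q, hqm, hqi, hqd⟩ (hs (Finset.mem_singleton_self _))]
      · exact (transfer_apply_tame hqm hqi hqd hd (hD q hqm hqi) f hq hf).symm
      · rintro ⟨p, hpm, hpi, hpd⟩ _ hpq
        have hpq' : p ≠ q := fun h => hpq (Subtype.ext h)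
        choose g hgd hg using hf
        simp only [ψ, AddMonoidHom.comp_apply]
        rw [(hD p hpm hpi).2 (Fin.cons q g : Fin (n + 1) → F[X]) ?_ f ?_, map_zero]
        · refine Fin.cases ?_ fun i => ?_
          · refine ((hpi.coprime_iff_not_dvd).2 fun h => hpq' ?_).symm
            exact eq_of_monic_of_associated hpm hqm (hpi.associated_of_dvd hqi h)
          · exact isCoprime_of_natDegree_lt (p := g i) hpi
              (fun h => (f i.succ).ne_zero (by rw [hg, h, map_zero])) (hpd.symm ▸ hgd i)
        · exact Fin.cases hq hg
  obtain ⟨s, hs⟩ := hB hz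
  rw [← QuotientAddGroup.eq_zero_iff, hs s subset_rfl]
  refine Finset.sum_eq_zero fun p _ => ?_
  simp only [ψ, AddMonoidHom.comp_apply]
  rw [hDz p.1 p.2.1 p.2.2.1, map_zero]

theorem mem_lowDegree_one_of_tame_eq_zero
    (hD : ∀ q : F[X], q.Monic → Irreducible q → IsTameSymbol F n q (D q))
    {z : MilnorK (RatFunc F) (n + 1)} (hDz : ∀ q : F[X], q.Monic → Irreducible q → D q z = 0) :
    z ∈ lowDegree F (n + 1) 1 := by
  obtain ⟨d, hz⟩ := exists_mem_lowDegree z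
  have h : z ∈ lowDegree F (n + 1) (d + 1) := lowDegree_mono _ d.le_succ hz
  clear hz
  induction d with
  | zero => exact h
  | succ d ih => exact ih (mem_lowDegree_of_tame_eq_zero hD d.succ_pos h hDz)

theorem finite_setOf_monic_irreducible_dvd {p : F[X]} (hp : p ≠ 0) :
    {q : {q : F[X] // q.Monic ∧ Irreducible q} | q.1 ∣ p}.Finite := by
  classical
  refine Set.Finite.of_injOn (f := Subtype.val)
    (t := ↑(UniqueFactorizationMonoid.normalizedFactors p).toFinset) ?_
    Subtype.val_injective.injOn (Finset.finite_toSet _)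
  rintro ⟨q, hqm, hqi⟩ hq
  rw [Finset.mem_coe, Multiset.mem_toFinset,
    UniqueFactorizationMonoid.mem_normalizedFactors_iff' hp]
  exact ⟨hqi, hqm.normalize_eq_self, hq⟩

theorem exists_tame_eq
    (hD : ∀ q : F[X], q.Monic → Irreducible q → IsTameSymbol F n q (D q))
    (c : DirectSum {p : F[X] // p.Monic ∧ Irreducible p}
      (fun p => MilnorK (F[X] ⧸ Ideal.span {p.1}) n)) :
    ∃ z : MilnorK (RatFunc F) (n + 1),
      ∀ p : {p : F[X] // p.Monic ∧ Irreducible p}, D p.1 z = c p := by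
  classical
  let R : AddSubgroup (DirectSum {p : F[X] // p.Monic ∧ Irreducible p}
      (fun p => MilnorK (F[X] ⧸ Ideal.span {p.1}) n)) :=
    { carrier := {c | ∃ z, ∀ p, D p.1 z = c p}
      zero_mem' := ⟨0, fun p => by simp⟩
      add_mem' := by
        rintro a b ⟨x, hx⟩ ⟨y, hy⟩
        exact ⟨x + y, fun p => by rw [map_add, hx, hy, DirectSum.add_apply]⟩
      neg_mem' := by
        rintro a ⟨x, hx⟩
        exact ⟨-x, fun p => by rw [map_neg, hx]; rfl⟩ }
  have key : ∀ (d : ℕ) (p : {p : F[X] // p.Monic ∧ Irreducible p}), p.1.natDegree = d →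
      ∀ x : MilnorK (F[X] ⧸ Ideal.span {p.1}) n,
        DirectSum.of (fun p : {p : F[X] // p.Monic ∧ Irreducible p} =>
          MilnorK (F[X] ⧸ Ideal.span {p.1}) n) p x ∈ R := by
    intro d
    induction d using Nat.strong_induction_on with
    | _ d ih =>
    intro p hpd x
    obtain ⟨hpm, hpi⟩ := p.2
    have hd : 0 < d := hpd ▸ hpi.natDegree_pos
    have hx : x ∈ AddSubgroup.closure
        (Set.range (MilnorSymbol (R := F[X] ⧸ Ideal.span {p.1}) (n := n))) := by
      rw [closure_range_symbol]
      trivial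
    suffices H : AddSubgroup.closure
        (Set.range (MilnorSymbol (R := F[X] ⧸ Ideal.span {p.1}) (n := n))) ≤
        R.comap (DirectSum.of (fun p : {p : F[X] // p.Monic ∧ Irreducible p} =>
          MilnorK (F[X] ⧸ Ideal.span {p.1}) n) p) from H hx
    rw [AddSubgroup.closure_le]
    rintro _ ⟨v, rfl⟩
    change DirectSum.of _ p (MilnorSymbol v) ∈ R
    set g : Fin n → F[X] := fun i => residueRep p.1 (v i)
    have hg0 : ∀ i, g i ≠ 0 := fun i => residueRep_ne_zero hpi (v i)
    have hgd : ∀ i, (g i).natDegree < d := fun i => natDegree_residueRep_lt hpm hpd hd _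
    set f : Fin (n + 1) → (RatFunc F)ˣ :=
      Fin.cons (polyUnit hpm.ne_zero) (residueUnit hpi ∘ v)
    have hDp : D p.1 (MilnorSymbol f) = MilnorSymbol v :=
      (hD p.1 hpm hpi).1 g (fun i => isCoprime_of_natDegree_lt hpi (hg0 i) (hpd.symm ▸ hgd i))
        f v rfl (fun i => rfl) (fun i => (mk_residueRep _).symm)
    have hfin : {q : {q : F[X] // q.Monic ∧ Irreducible q} | ∃ i, q.1 ∣ g i}.Finite := by
      rw [Set.ofPred_exists]
      exact Set.finite_iUnion fun i => finite_setOf_monic_irreducible_dvd (hg0 i)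
    have hlt : ∀ q ∈ hfin.toFinset, q.1.natDegree < d := by
      intro q hq
      obtain ⟨i, hi⟩ := (Set.Finite.mem_toFinset _).1 hq
      exact (natDegree_le_of_dvd hi (hg0 i)).trans_lt (hgd i)
    have hDq : ∀ q : {q : F[X] // q.Monic ∧ Irreducible q}, q ≠ p → q ∉ hfin.toFinset →
        D q.1 (MilnorSymbol f) = 0 := by
      intro q hqp hq
      have hq' : ∀ i, ¬q.1 ∣ g i := by
        intro i hi
        exact hq ((Set.Finite.mem_toFinset _).2 ⟨i, hi⟩)
      refine (hD q.1 q.2.1 q.2.2).2 (Fin.cons p.1 g : Fin (n + 1) → F[X]) ?_ f ?_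
      · refine Fin.cases ?_ fun i => ?_
        · refine ((q.2.2.coprime_iff_not_dvd).2 fun h => hqp (Subtype.ext ?_)).symm
          exact eq_of_monic_of_associated q.2.1 hpm (q.2.2.associated_of_dvd hpi h)
        · exact ((q.2.2.coprime_iff_not_dvd).2 (hq' i)).symm
      · exact Fin.cases rfl fun i => rfl
    set e := ∑ q ∈ hfin.toFinset,
      DirectSum.of (fun p : {p : F[X] // p.Monic ∧ Irreducible p} =>
          MilnorK (F[X] ⧸ Ideal.span {p.1}) n) q (D q.1 (MilnorSymbol f)) with he
    have heR : e ∈ R := sum_mem fun q hq => ih _ (hlt q hq) q rfl _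
    have hsum : DirectSum.of (fun p : {p : F[X] // p.Monic ∧ Irreducible p} =>
          MilnorK (F[X] ⧸ Ideal.span {p.1}) n) p (MilnorSymbol v) + e ∈ R := by
      refine ⟨MilnorSymbol f, fun q => ?_⟩
      rw [DirectSum.add_apply, he, DFinsupp.finsetSum_apply]
      by_cases hqp : q = p
      · subst hqp
        rw [DirectSum.of_eq_same, hDp, Finset.sum_eq_zero, add_zero]
        intro r hr
        refine DirectSum.of_eq_of_ne _ _ _ ?_
        rintro rfl
        exact (hlt _ hr).ne hpd
      · rw [DirectSum.of_eq_of_ne _ _ _ hqp, zero_add]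
        by_cases hq : q ∈ hfin.toFinset
        · rw [Finset.sum_eq_single_of_mem q hq, DirectSum.of_eq_same]
          intro r _ hr
          exact DirectSum.of_eq_of_ne _ _ _ hr.symm
        · rw [hDq q hqp hq, Finset.sum_eq_zero]
          intro r hr
          refine DirectSum.of_eq_of_ne _ _ _ ?_
          rintro rfl
          exact hq hr
    simpa using sub_mem hsum heR
  have hc : c ∈ R := by
    induction c using DirectSum.induction_on with
    | zero => exact zero_mem _
    | of p x => exact key _ p rfl x
    | add x y hx hy => exact add_mem hx hy
  exact hc

end Sequence

section Inclusion

variable {n : ℕ} {iStar : MilnorK F n →+ MilnorK (RatFunc F) n}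

theorem inclusion_injective
    (hi : ∀ (a : Fin n → Fˣ) (u : Fin n → (RatFunc F)ˣ),
      (∀ i, (u i : RatFunc F) = algebraMap F (RatFunc F) (a i)) →
      iStar (MilnorSymbol a) = MilnorSymbol u) : Injective iStar := by
  have h : ∀ x ∈ AddSubgroup.closure (Set.range (MilnorSymbol (R := F) (n := n))),
      specialize F n (iStar x) = x := by
    intro x hx
    induction hx using AddSubgroup.closure_induction with
    | mem x hx =>
      obtain ⟨a, rfl⟩ := hx
      rw [hi a (fun i => Units.map (algebraMap F (RatFunc F)).toMonoidHom (a i)) fun i => rfl,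
        specialize_symbol]
      congr 1
      ext i
      change (algebraMap F (RatFunc F) (a i)).num.leadingCoeff = _
      simp [RatFunc.algebraMap_eq_C]
    | zero => simp
    | add x y _ _ hx hy => rw [map_add, map_add, hx, hy]
    | neg x _ hx => rw [map_neg, map_neg, hx]
  rw [closure_range_symbol] at h
  exact LeftInverse.injective (g := specialize F n) fun x => h x trivial

theorem range_inclusion
    (hi : ∀ (a : Fin n → Fˣ) (u : Fin n → (RatFunc F)ˣ),
      (∀ i, (u i : RatFunc F) = algebraMap F (RatFunc F) (a i)) →
      iStar (MilnorSymbol a) = MilnorSymbol u) : iStar.range = lowDegree F n 1 := by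
  apply le_antisymm
  · rw [AddMonoidHom.range_eq_map, ← closure_range_symbol, AddMonoidHom.map_closure,
      AddSubgroup.closure_le]
    rintro _ ⟨_, ⟨a, rfl⟩, rfl⟩
    rw [hi a (fun i => Units.map (algebraMap F (RatFunc F)).toMonoidHom (a i)) fun i => rfl]
    exact symbol_mem_lowDegree fun i => mem_lowUnits (p := C (a i : F)) (by simp)
      (by simp [RatFunc.algebraMap_eq_C])
  · refine lowDegree_le fun f hf => ?_
    have hf' : ∀ i, ∃ a : Fˣ, (f i : RatFunc F) = algebraMap F (RatFunc F) a := by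
      intro i
      obtain ⟨p, hp, hfp⟩ := hf i
      obtain ⟨a, rfl⟩ := natDegree_eq_zero.1 (Nat.lt_one_iff.1 hp)
      have ha : a ≠ 0 := by
        rintro rfl
        exact (f i).ne_zero (by rw [hfp, C_0, map_zero])
      exact ⟨Units.mk0 a ha, by simp [hfp, RatFunc.algebraMap_eq_C]⟩
    choose a ha using hf'
    exact ⟨MilnorSymbol a, hi a f ha⟩

end Inclusion

end RatFunc

end MilnorK

/-- Milnor's split exact sequence: the sequence
`0 → K^M_{n+1}(F) → K^M_{n+1}(F(t)) → ⊕_π K^M_n(F[t]/(π)) → 0` is exact, where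
the first map is induced by `F ⊂ F(t)` and the sum is over all monic irreducible
`π ∈ F[t]`; in particular `⊕_π ∂_π` is surjective. -/
theorem milnor_exact_sequence (F : Type*) [Field F] (n : ℕ)
    (D : ∀ q : F[X],
      MilnorK (RatFunc F) (n + 1) →+ MilnorK (F[X] ⧸ Ideal.span {q}) n)
    (hD : ∀ q : F[X], q.Monic → Irreducible q → IsTameSymbol F n q (D q))
    (iStar : MilnorK F (n + 1) →+ MilnorK (RatFunc F) (n + 1))
    (hi : ∀ (a : Fin (n + 1) → Fˣ) (u : Fin (n + 1) → (RatFunc F)ˣ),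
      (∀ i, (u i : RatFunc F) = algebraMap F (RatFunc F) (a i)) →
      iStar (MilnorSymbol a) = MilnorSymbol u) :
    Function.Injective iStar ∧
    (∀ z : MilnorK (RatFunc F) (n + 1),
      (∀ q : F[X], q.Monic → Irreducible q → D q z = 0) ↔ z ∈ Set.range iStar) ∧
    (∀ c : DirectSum {p : F[X] // p.Monic ∧ Irreducible p}
        (fun p => MilnorK (F[X] ⧸ Ideal.span {p.1}) n),
      ∃ z : MilnorK (RatFunc F) (n + 1),
        ∀ p : {p : F[X] // p.Monic ∧ Irreducible p}, D p.1 z = c p) := by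
  have hrange := MilnorK.range_inclusion hi
  refine ⟨MilnorK.inclusion_injective hi, fun z => ?_, MilnorK.exists_tame_eq hD⟩
  rw [← AddMonoidHom.coe_range, SetLike.mem_coe, hrange]
  exact ⟨MilnorK.mem_lowDegree_one_of_tame_eq_zero hD, fun hz q hqm hqi =>
    MilnorK.tame_eq_zero_of_mem_lowDegree hqi hqi.natDegree_pos (hD q hqm hqi) hz⟩
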